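/- Let n > 1 be an odd squarefree integer and let p be an odd prime not dividing n. Then C_{np} ≤ (⌊φ(n)/p⌋ + 1) · A_n · C_n, where A_n is the height of Φ_n, C_m is the height of (X^m − 1)/Φ_m(X), and φ is Euler's totient function. -/

import Mathlib

open Polynomial

/-- The height of an integer polynomial: the maximum of the absolute values of its
coefficients (`0` for the zero polynomial). -/
noncomputable def polyHeight (f : ℤ[X]) : ℕ := f.support.sup fun m => (f.coeff m).natAbs

/-- `A n` is the height of the `n`-th cyclotomic polynomial. -/
noncomputable def A (n : ℕ) : ℕ := polyHeight (cyclotomic n ℤ)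

/-- `C m` is the height of the polynomial `(X^m - 1) / Φ_m(X)` (exact division,
realized via division by the monic polynomial `Φ_m`). -/
noncomputable def Cinv (m : ℕ) : ℕ := polyHeight ((X ^ m - 1) /ₘ cyclotomic m ℤ)

theorem natAbs_coeff_le_polyHeight (f : ℤ[X]) (k : ℕ) : (f.coeff k).natAbs ≤ polyHeight f := by
  by_cases h : f.coeff k = 0
  · simp [h]
  · exact Finset.le_sup (f := fun m => (f.coeff m).natAbs) (mem_support_iff.2 h)

theorem card_antidiagonal_filter_dvd_le (N k p : ℕ) :
    ((Finset.HasAntidiagonal.antidiagonal k).filter fun x => x.1 ≤ N ∧ p ∣ x.2).card ≤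
      N / p + 1 := by
  rw [← Finset.card_range (N / p + 1)]
  refine Finset.card_le_card_of_injOn (fun x => x.1 / p) ?_ ?_
  · intro x hx
    simp only [Finset.coe_filter, Finset.HasAntidiagonal.mem_antidiagonal, Set.mem_ofPred_eq] at hx
    simpa [Nat.lt_succ_iff] using Nat.div_le_div_right hx.2.1
  · rintro ⟨a, b⟩ hx ⟨c, d⟩ hy hxy
    simp only [Finset.coe_filter, Finset.HasAntidiagonal.mem_antidiagonal,
      Set.mem_ofPred_eq] at hx hy hxy
    obtain ⟨hab, -, u, rfl⟩ := hx
    obtain ⟨hcd, -, v, rfl⟩ := hy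
    have hmod : a % p = c % p := by
      have h : (a + p * u) % p = (c + p * v) % p := by rw [hab, hcd]
      simpa using h
    have hac : a = c := by rw [← Nat.div_add_mod a p, ← Nat.div_add_mod c p, hxy, hmod]
    ext <;> simp only <;> omega

theorem polyHeight_mul_expand_le (f g : ℤ[X]) {p : ℕ} (hp : 0 < p) :
    polyHeight (f * expand ℤ p g) ≤ (f.natDegree / p + 1) * polyHeight f * polyHeight g := by
  refine Finset.sup_le fun k _ => ?_
  rw [coeff_mul, ← Finset.sum_filter_of_ne
    (p := fun x : ℕ × ℕ => x.1 ≤ f.natDegree ∧ p ∣ x.2)]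
  · refine (Int.natAbs_sum_le _ _).trans ((Finset.sum_le_card_nsmul _ _
      (polyHeight f * polyHeight g) fun x _ => ?_).trans ?_)
    · rw [Int.natAbs_mul, coeff_expand hp]
      refine Nat.mul_le_mul (natAbs_coeff_le_polyHeight f _) ?_
      split_ifs
      · exact natAbs_coeff_le_polyHeight g _
      · simp
    · rw [smul_eq_mul, mul_assoc]
      exact Nat.mul_le_mul_right _ (card_antidiagonal_filter_dvd_le _ k p)
  · intro x _ hx
    refine ⟨le_natDegree_of_ne_zero (left_ne_zero_of_mul hx), ?_⟩
    by_contra h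
    exact right_ne_zero_of_mul hx (by rw [coeff_expand hp, if_neg h])

theorem cyclotomic_mul_X_pow_sub_one_divByMonic (m : ℕ) :
    cyclotomic m ℤ * ((X ^ m - 1) /ₘ cyclotomic m ℤ) = X ^ m - 1 := by
  have h := modByMonic_add_div (X ^ m - 1 : ℤ[X]) (cyclotomic m ℤ)
  rwa [(modByMonic_eq_zero_iff_dvd (cyclotomic.monic m ℤ)).2 (cyclotomic.dvd_X_pow_sub_one m ℤ),
    zero_add] at h

theorem X_pow_sub_one_divByMonic_cyclotomic_mul_prime {n p : ℕ} (hp : p.Prime) (hpn : ¬ p ∣ n) :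
    (X ^ (n * p) - 1) /ₘ cyclotomic (n * p) ℤ =
      cyclotomic n ℤ * expand ℤ p ((X ^ n - 1) /ₘ cyclotomic n ℤ) := by
  refine mul_left_cancel₀ (cyclotomic_ne_zero (n * p) ℤ) ?_
  rw [cyclotomic_mul_X_pow_sub_one_divByMonic, ← mul_assoc,
    ← cyclotomic_expand_eq_cyclotomic_mul hp hpn, ← map_mul,
    cyclotomic_mul_X_pow_sub_one_divByMonic]
  simp [← pow_mul, mul_comm]

/-- **(Bzdęga, proof of Theorem 2).** For `n > 1` odd squarefree and `p` an odd prime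
not dividing `n`, `C (np) ≤ (⌊φ(n)/p⌋ + 1) · A n · C n`. -/
theorem height_cyclotomic_stmt15 (n p : ℕ) (hn1 : 1 < n) (hodd : Odd n)
    (hsf : Squarefree n) (hp : p.Prime) (hpodd : Odd p) (hpn : ¬ p ∣ n) :
    Cinv (n * p) ≤ (n.totient / p + 1) * A n * Cinv n := by
  rw [Cinv, X_pow_sub_one_divByMonic_cyclotomic_mul_prime hp hpn, ← natDegree_cyclotomic n ℤ]
  exact polyHeight_mul_expand_le _ _ hp.pos
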